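/- Let T be a type of vertex labels and let B be a finite family of finite vertex-labeled DAGs (a subgraph basis), where each basis element g ∈ B carries two distinguished vertices in(g) (its entry) and out(g) (its exit). Suppose G₁ and G₂ are finite vertex-labeled DAGs admitting B-decompositions (P₁, ℓ₁, φ₁) and (P₂, ℓ₂, φ₂) respectively. If there is a bijection ψ between the blocks of P₁ and the blocks of P₂ that preserves the basis labels (ℓ₂(ψ(b)) = ℓ₁(b) for every block b of P₁) and preserves the quotient edge relation in both directions (the quotient of G₁ by P₁ has an edge b → b' if and only if the quotient of G₂ by P₂ has an edge ψ(b) → ψ(b')), then G₁ and G₂ are isomorphic as vertex-labeled DAGs. (This is the injectivity core of Theorem 3.2: the labeled transformed DAG G' determines the input circuit G up to isomorphism.) -/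

import Mathlib

/-- A finite vertex-labeled DAG over a label type `T`: a finite vertex type `V`
equipped with a label function `lab : V → T` and an edge relation `edge` whose
transitive closure is irreflexive (acyclicity). -/
structure LDAG (T : Type) where
  V : Type
  fin : Fintype V
  lab : V → T
  edge : V → V → Prop
  acyclic : ∀ v : V, ¬ Relation.TransGen edge v v

attribute [instance] LDAG.fin

/-- An isomorphism of vertex-labeled DAGs: a bijection of vertex sets preserving
labels and preserving the edge relation in both directions. -/
structure LDAGIso {T : Type} (G₁ G₂ : LDAG T) where
  toEquiv : G₁.V ≃ G₂.V
  lab_eq : ∀ v : G₁.V, G₂.lab (toEquiv v) = G₁.lab v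
  edge_iff : ∀ u v : G₁.V, G₂.edge (toEquiv u) (toEquiv v) ↔ G₁.edge u v

/-- An element of a subgraph basis: a finite vertex-labeled DAG equipped with
distinguished entry (`inV`) and exit (`outV`) vertices. -/
structure BasisElem (T : Type) extends LDAG T where
  inV : V
  outV : V

/-- A `B`-decomposition of a finite vertex-labeled DAG `G`: a partition of the
vertex set of `G` (given by the fibers of a surjection `blk` onto a finite type
`β` of blocks), together with, for each block `b`, a basis element `B (lbl b)`
and a label-preserving isomorphism `φ b` from the induced labeled sub-DAG on the
block `b` to `B (lbl b)`, such that every edge of `G` crossing between two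
distinct blocks has its tail at the preimage of the exit vertex of its block's
basis element and its head at the preimage of the entry vertex of its block's
basis element. -/
structure BDecomp {T ι : Type} (B : ι → BasisElem T) (G : LDAG T) where
  β : Type
  finβ : Fintype β
  blk : G.V → β
  blk_surj : Function.Surjective blk
  lbl : β → ι
  φ : (b : β) → {v : G.V // blk v = b} ≃ (B (lbl b)).V
  lab_pres : ∀ (b : β) (v : {v : G.V // blk v = b}),
    (B (lbl b)).lab (φ b v) = G.lab v.1
  edge_pres : ∀ (b : β) (u v : {v : G.V // blk v = b}),
    (B (lbl b)).edge (φ b u) (φ b v) ↔ G.edge u.1 v.1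
  cross_tail : ∀ u v : G.V, G.edge u v → blk u ≠ blk v →
    φ (blk u) ⟨u, rfl⟩ = (B (lbl (blk u))).outV
  cross_head : ∀ u v : G.V, G.edge u v → blk u ≠ blk v →
    φ (blk v) ⟨v, rfl⟩ = (B (lbl (blk v))).inV

attribute [instance] BDecomp.finβ

/-- The edge relation of the quotient of `G` by the partition of a
`B`-decomposition: there is an edge `b → b'` exactly when `b ≠ b'` and some edge
of `G` goes from a vertex of block `b` to a vertex of block `b'`. -/
def BDecomp.qedge {T ι : Type} {B : ι → BasisElem T} {G : LDAG T}
    (D : BDecomp B G) (b b' : D.β) : Prop :=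
  b ≠ b' ∧ ∃ u v : G.V, G.edge u v ∧ D.blk u = b ∧ D.blk v = b'

namespace BasisElem

/-- The identification of the vertex sets of two basis elements with equal indices. -/
def castV {T ι : Type} (B : ι → BasisElem T) {i j : ι} (h : i = j) : (B i).V ≃ (B j).V :=
  Equiv.cast (congrArg (fun k => (B k).V) h)

variable {T ι : Type} (B : ι → BasisElem T) {i j : ι} (h : i = j)

theorem lab_castV (x : (B i).V) : (B j).lab (castV B h x) = (B i).lab x := by
  subst h; rfl

theorem edge_castV (x y : (B i).V) :
    (B j).edge (castV B h x) (castV B h y) ↔ (B i).edge x y := by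
  subst h; rfl

theorem castV_eq_inV (x : (B i).V) : castV B h x = (B j).inV ↔ x = (B i).inV := by
  subst h; rfl

theorem castV_eq_outV (x : (B i).V) : castV B h x = (B j).outV ↔ x = (B i).outV := by
  subst h; rfl

end BasisElem

namespace BDecomp

variable {T ι : Type} {B : ι → BasisElem T} {G : LDAG T} (D : BDecomp B G)

/-- Vertices of a decomposed graph are pairs of a block and a vertex of its basis element. -/
def sigmaEquiv : (Σ b : D.β, (B (D.lbl b)).V) ≃ G.V :=
  (Equiv.sigmaCongrRight D.φ).symm.trans (Equiv.sigmaFiberEquiv D.blk)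

theorem sigmaEquiv_mk (b : D.β) (x : (B (D.lbl b)).V) :
    D.sigmaEquiv ⟨b, x⟩ = ((D.φ b).symm x).1 := rfl

theorem blk_sigmaEquiv (p : Σ b : D.β, (B (D.lbl b)).V) : D.blk (D.sigmaEquiv p) = p.1 :=
  ((D.φ p.1).symm p.2).2

theorem lab_sigmaEquiv (p : Σ b : D.β, (B (D.lbl b)).V) :
    G.lab (D.sigmaEquiv p) = (B (D.lbl p.1)).lab p.2 := by
  obtain ⟨b, x⟩ := p
  rw [sigmaEquiv_mk, ← D.lab_pres, Equiv.apply_symm_apply]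

theorem edge_sigmaEquiv_same (b : D.β) (x y : (B (D.lbl b)).V) :
    G.edge (D.sigmaEquiv ⟨b, x⟩) (D.sigmaEquiv ⟨b, y⟩) ↔ (B (D.lbl b)).edge x y := by
  rw [sigmaEquiv_mk, sigmaEquiv_mk, ← D.edge_pres, Equiv.apply_symm_apply,
    Equiv.apply_symm_apply]

theorem sigmaEquiv_blk (u : G.V) : D.sigmaEquiv ⟨D.blk u, D.φ (D.blk u) ⟨u, rfl⟩⟩ = u := by
  rw [sigmaEquiv_mk, Equiv.symm_apply_apply]

theorem sigmaEquiv_outV {u v : G.V} (h : G.edge u v) (hne : D.blk u ≠ D.blk v) :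
    D.sigmaEquiv ⟨D.blk u, (B (D.lbl (D.blk u))).outV⟩ = u := by
  rw [← D.cross_tail u v h hne, sigmaEquiv_blk]

theorem sigmaEquiv_inV {u v : G.V} (h : G.edge u v) (hne : D.blk u ≠ D.blk v) :
    D.sigmaEquiv ⟨D.blk v, (B (D.lbl (D.blk v))).inV⟩ = v := by
  rw [← D.cross_head u v h hne, sigmaEquiv_blk]

theorem edge_sigmaEquiv_of_ne {b b' : D.β} (hne : b ≠ b')
    (x : (B (D.lbl b)).V) (y : (B (D.lbl b')).V) :
    G.edge (D.sigmaEquiv ⟨b, x⟩) (D.sigmaEquiv ⟨b', y⟩) ↔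
      D.qedge b b' ∧ x = (B (D.lbl b)).outV ∧ y = (B (D.lbl b')).inV := by
  constructor
  · intro h
    have hb := D.blk_sigmaEquiv ⟨b, x⟩
    have hb' := D.blk_sigmaEquiv ⟨b', y⟩
    have hn : D.blk (D.sigmaEquiv ⟨b, x⟩) ≠ D.blk (D.sigmaEquiv ⟨b', y⟩) := by
      rwa [hb, hb']
    have hu := D.sigmaEquiv_outV h hn
    have hv := D.sigmaEquiv_inV h hn
    rw [hb] at hu
    rw [hb'] at hv
    exact ⟨⟨hne, _, _, h, hb, hb'⟩,
      (sigma_mk_injective (D.sigmaEquiv.injective hu)).symm,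
      (sigma_mk_injective (D.sigmaEquiv.injective hv)).symm⟩
  · rintro ⟨⟨-, u, v, h, rfl, rfl⟩, rfl, rfl⟩
    rwa [D.sigmaEquiv_outV h hne, D.sigmaEquiv_inV h hne]

end BDecomp

/-- If `G₁` and `G₂` admit `B`-decompositions whose labeled
quotient DAGs are isomorphic (via a bijection of blocks preserving basis labels
and the quotient edge relation in both directions), then `G₁` and `G₂` are
isomorphic as vertex-labeled DAGs. -/
theorem injectivity_core {T ι : Type} [Fintype ι] (B : ι → BasisElem T)
    (G₁ G₂ : LDAG T) (D₁ : BDecomp B G₁) (D₂ : BDecomp B G₂)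
    (ψ : D₁.β ≃ D₂.β)
    (hlab : ∀ b : D₁.β, D₂.lbl (ψ b) = D₁.lbl b)
    (hedge : ∀ b b' : D₁.β, D₁.qedge b b' ↔ D₂.qedge (ψ b) (ψ b')) :
    Nonempty (LDAGIso G₁ G₂) := by
  let σ : (Σ b : D₁.β, (B (D₁.lbl b)).V) ≃ (Σ b : D₂.β, (B (D₂.lbl b)).V) :=
    ψ.sigmaCongr fun b => BasisElem.castV B (hlab b).symm
  have hσ (b : D₁.β) (x : (B (D₁.lbl b)).V) :
      σ ⟨b, x⟩ = ⟨ψ b, BasisElem.castV B (hlab b).symm x⟩ := rfl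
  refine ⟨⟨D₁.sigmaEquiv.symm.trans (σ.trans D₂.sigmaEquiv), fun v => ?_, fun u v => ?_⟩⟩
  · obtain ⟨⟨b, x⟩, rfl⟩ := D₁.sigmaEquiv.surjective v
    simp only [Equiv.trans_apply, Equiv.symm_apply_apply, BDecomp.lab_sigmaEquiv, hσ,
      BasisElem.lab_castV]
  · obtain ⟨⟨b, x⟩, rfl⟩ := D₁.sigmaEquiv.surjective u
    obtain ⟨⟨b', y⟩, rfl⟩ := D₁.sigmaEquiv.surjective v
    simp only [Equiv.trans_apply, Equiv.symm_apply_apply, hσ]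
    by_cases hb : b = b'
    · subst hb
      rw [D₁.edge_sigmaEquiv_same, D₂.edge_sigmaEquiv_same, BasisElem.edge_castV]
    · rw [D₁.edge_sigmaEquiv_of_ne hb, D₂.edge_sigmaEquiv_of_ne (ψ.injective.ne hb), ← hedge,
        BasisElem.castV_eq_outV, BasisElem.castV_eq_inV]
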